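/- Let t ≥ 1 and n ≥ 2t + 1 be integers, and let G be the consecutive circulant graph Circ[n, {1,2,...,t}]. Then κ(G) = δ(G) = ξ(G) = M(G) = Z(G) = 2t. -/

import Mathlib

open scoped Classical

noncomputable section

namespace Paper

variable {V : Type*}

/-- The set of vertices eventually colored blue starting from `Z` under the
zero forcing color change rule. -/
inductive Forced (G : SimpleGraph V) (Z : Set V) : V → Prop
  | init (v : V) : v ∈ Z → Forced G Z v
  | force (u w : V) : Forced G Z u → G.Adj u w →
      (∀ x, G.Adj u x → x ≠ w → Forced G Z x) → Forced G Z w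

/-- `Z` is a zero forcing set of `G`. -/
def IsZeroForcingSet (G : SimpleGraph V) (Z : Set V) : Prop := ∀ v, Forced G Z v

/-- The zero forcing number `Z(G)`. -/
def zfn (G : SimpleGraph V) : ℕ :=
  sInf {m | ∃ Z : Set V, Z.ncard = m ∧ IsZeroForcingSet G Z}

/-- Membership in the set `S(F,G)` of symmetric matrices described by `G`. -/
def SMat (F : Type*) [Field F] (G : SimpleGraph V) (A : Matrix V V F) : Prop :=
  A.IsSymm ∧ ∀ i j : V, i ≠ j → (A i j ≠ 0 ↔ G.Adj i j)

/-- Maximum nullity `M(F,G)`. -/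
def maxNullity (F : Type*) [Field F] [Fintype V] (G : SimpleGraph V) : ℕ :=
  sSup {m | ∃ A : Matrix V V F, SMat F G A ∧ Fintype.card V - A.rank = m}

/-- Minimum rank `mr(F,G)`. -/
def minRank (F : Type*) [Field F] [Fintype V] (G : SimpleGraph V) : ℕ :=
  sInf {m | ∃ A : Matrix V V F, SMat F G A ∧ A.rank = m}

/-- The Strong Arnold Property. -/
def HasSAP [Fintype V] [DecidableEq V] (A : Matrix V V ℝ) : Prop :=
  ∀ X : Matrix V V ℝ, X.IsSymm → A * X = 0 → Matrix.hadamard A X = 0 →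
    Matrix.hadamard (1 : Matrix V V ℝ) X = 0 → X = 0

/-- The Colin de Verdière type parameter `ξ(G)`. -/
def xi [Fintype V] [DecidableEq V] (G : SimpleGraph V) : ℕ :=
  sSup {m | ∃ A : Matrix V V ℝ, SMat ℝ G A ∧ HasSAP A ∧ Fintype.card V - A.rank = m}

/-- The adjacency matrix of `G` with entries in `R`. -/
def adjMat (R : Type*) [Zero R] [One R] (G : SimpleGraph V) : Matrix V V R :=
  Matrix.of fun i j => if G.Adj i j then 1 else 0

/-- Minimum degree `δ(G)`. -/
def minDeg (G : SimpleGraph V) : ℕ :=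
  sInf {d | ∃ v : V, (G.neighborSet v).ncard = d}

/-- Vertex connectivity `κ(G)`. -/
def vertexConnectivity [Fintype V] (G : SimpleGraph V) : ℕ :=
  if G = (⊤ : SimpleGraph V) then Fintype.card V - 1
  else sInf {m | ∃ S : Set V, S.ncard = m ∧ ¬ (G.induce Sᶜ).Connected}

/-- The circulant graph `Circ[n,S]`. -/
def circG (n : ℕ) (S : Set ℕ) : SimpleGraph (ZMod n) :=
  SimpleGraph.fromRel (fun i j => ∃ s ∈ S, j = i + (s : ZMod n))


/-- The monic real polynomial of degree `2 * t` with roots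
`exp (± (2 * k + 1) π i / n)`, `k < t`. -/
def halfAnglePoly (t n : ℕ) : Polynomial ℝ :=
  ∏ k ∈ Finset.range t,
    (Polynomial.X ^ 2 - Polynomial.C (2 * Real.cos ((2 * k + 1) * Real.pi / n)) * Polynomial.X + 1)

lemma natDegree_quadratic (a : ℝ) :
    (Polynomial.X ^ 2 - Polynomial.C a * Polynomial.X + 1 : Polynomial ℝ).natDegree = 2 := by
  compute_degree!

lemma monic_quadratic (a : ℝ) :
    (Polynomial.X ^ 2 - Polynomial.C a * Polynomial.X + 1 : Polynomial ℝ).Monic := by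
  monicity!

lemma reverse_quadratic (a : ℝ) :
    (Polynomial.X ^ 2 - Polynomial.C a * Polynomial.X + 1 : Polynomial ℝ).reverse =
      Polynomial.X ^ 2 - Polynomial.C a * Polynomial.X + 1 := by
  ext m
  rw [Polynomial.coeff_reverse, natDegree_quadratic]
  rcases le_or_gt m 2 with h | h
  · rw [Polynomial.revAt_le h]
    interval_cases m <;> simp [Polynomial.coeff_X, Polynomial.coeff_one]
  · rw [Polynomial.revAt_eq_self_of_lt h]

lemma monic_halfAnglePoly (t n : ℕ) : (halfAnglePoly t n).Monic :=
  Polynomial.monic_prod_of_monic _ _ fun _ _ => monic_quadratic _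

lemma natDegree_halfAnglePoly (t n : ℕ) : (halfAnglePoly t n).natDegree = 2 * t := by
  rw [halfAnglePoly, Polynomial.natDegree_prod_of_monic _ _ fun _ _ => monic_quadratic _,
    Finset.sum_congr rfl fun _ _ => natDegree_quadratic _]
  simp [mul_comm]

lemma reverse_halfAnglePoly (t n : ℕ) : (halfAnglePoly t n).reverse = halfAnglePoly t n := by
  induction t with
  | zero => simp [halfAnglePoly, Polynomial.reverse]
  | succ t ih =>
    have h : halfAnglePoly (t + 1) n = halfAnglePoly t n * _ := Finset.prod_range_succ _ _
    rw [h, Polynomial.reverse_mul_of_domain, ih, reverse_quadratic]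

lemma exp_quadratic (θ : ℂ) :
    Complex.exp (θ * Complex.I) ^ 2 - 2 * Complex.cos θ * Complex.exp (θ * Complex.I) + 1 = 0 := by
  have h : Complex.exp (-θ * Complex.I) * Complex.exp (θ * Complex.I) = 1 := by
    rw [← Complex.exp_add]; simp
  rw [Complex.cos]
  linear_combination -h

/-- The roots of `halfAnglePoly t n`, listed by increasing argument. -/
def halfAngleRoot (t n m : ℕ) : ℂ :=
  Complex.exp (((2 * m - 2 * t + 1) * Real.pi / n : ℂ) * Complex.I)

lemma halfAngleRoot_pow {n : ℕ} (hn : n ≠ 0) (t m : ℕ) : halfAngleRoot t n m ^ n = -1 := by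
  have hn' : (n : ℂ) ≠ 0 := by exact_mod_cast hn
  rw [halfAngleRoot, ← Complex.exp_nat_mul]
  have : (n : ℂ) * (((2 * m - 2 * t + 1) * Real.pi / n : ℂ) * Complex.I) =
      Real.pi * Complex.I + ((m - t : ℤ) : ℂ) * (2 * Real.pi * Complex.I) := by
    push_cast
    field_simp
    ring
  rw [this, Complex.exp_add, Complex.exp_int_mul_two_pi_mul_I, Complex.exp_pi_mul_I, mul_one]

lemma halfAngleRoot_eq (t n m : ℕ) :
    halfAngleRoot t n m = halfAngleRoot t n 0 * Complex.exp (2 * Real.pi * Complex.I / n) ^ m := by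
  rw [halfAngleRoot, halfAngleRoot, ← Complex.exp_nat_mul, ← Complex.exp_add]
  congr 1
  push_cast
  ring

lemma halfAngleRoot_ne_zero (t n m : ℕ) : halfAngleRoot t n m ≠ 0 := Complex.exp_ne_zero _

lemma rootOfUnity_pow_injOn {n a b : ℕ} (ha : a < n) (hb : b < n)
    (h : Complex.exp (2 * Real.pi * Complex.I / n) ^ a =
      Complex.exp (2 * Real.pi * Complex.I / n) ^ b) : a = b :=
  (Complex.isPrimitiveRoot_exp n (by omega)).pow_inj ha hb h

lemma aeval_halfAngleRoot {t m : ℕ} (n : ℕ) (hm : m < 2 * t) :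
    Polynomial.aeval (halfAngleRoot t n m) (halfAnglePoly t n) = 0 := by
  rw [halfAnglePoly, map_prod]
  set z := halfAngleRoot t n m with hz
  have key : ∀ k ∈ Finset.range t,
      Complex.cos ((2 * m - 2 * t + 1) * Real.pi / n : ℂ) =
        Complex.cos ((2 * k + 1) * Real.pi / n) →
      Polynomial.aeval z (Polynomial.X ^ 2 -
        Polynomial.C (2 * Real.cos ((2 * k + 1) * Real.pi / n)) * Polynomial.X + 1) = 0 := by
    intro k _ h
    have := exp_quadratic ((2 * m - 2 * t + 1) * Real.pi / n : ℂ)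
    rw [h] at this
    simp only [map_add, map_sub, map_mul, map_pow, Polynomial.aeval_X, Polynomial.aeval_C, map_one]
    simpa [hz, halfAngleRoot] using this
  rcases le_or_gt t m with h | h
  · have hk : m - t ∈ Finset.range t := by simp; omega
    refine Finset.prod_eq_zero hk (key _ hk ?_)
    congr 1
    push_cast [Nat.cast_sub h]
    ring
  · have hk : t - 1 - m ∈ Finset.range t := by simp; omega
    refine Finset.prod_eq_zero hk (key _ hk ?_)
    rw [← Complex.cos_neg]
    congr 1
    have : ((t - 1 - m : ℕ) : ℂ) = t - 1 - m := by
      have h' : ((t - 1 - m : ℕ) : ℂ) + 1 + m = t := by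
        exact_mod_cast (by omega : t - 1 - m + 1 + m = t)
      linear_combination h'
    rw [this]
    ring

lemma sum_coeff_halfAnglePoly {t m : ℕ} (n : ℕ) (hm : m < 2 * t) :
    ∑ j ∈ Finset.range (2 * t + 1),
      ((halfAnglePoly t n).coeff j : ℂ) * halfAngleRoot t n m ^ j = 0 := by
  have h := aeval_halfAngleRoot n hm
  rw [Polynomial.aeval_eq_sum_range, natDegree_halfAnglePoly] at h
  simpa using h

lemma coeff_halfAnglePoly_ne_zero {t n j : ℕ} (hn : 2 * t + 1 ≤ n) (hj : j ≤ 2 * t) :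
    (halfAnglePoly t n).coeff j ≠ 0 := by
  intro h0
  have hlead : (halfAnglePoly t n).coeff (2 * t) = 1 := by
    have := monic_halfAnglePoly t n
    rwa [Polynomial.Monic, Polynomial.leadingCoeff, natDegree_halfAnglePoly] at this
  set ω := Complex.exp (2 * Real.pi * Complex.I / n)
  set z := halfAngleRoot t n 0
  let J : Fin (2 * t + 1) := ⟨j, by omega⟩
  have hv : (fun i : Fin (2 * t) => ((halfAnglePoly t n).coeff (J.succAbove i) : ℂ) *
      z ^ (J.succAbove i : ℕ)) = 0 := by
    apply Matrix.eq_zero_of_forall_pow_sum_mul_pow_eq_zero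
      (f := fun i : Fin (2 * t) => ω ^ (J.succAbove i : ℕ))
    · intro a b hab
      have := rootOfUnity_pow_injOn (by omega) (by omega) hab
      exact Fin.succAbove_right_injective (Fin.ext this)
    · intro m
      have h := sum_coeff_halfAnglePoly n m.2
      rw [← Fin.sum_univ_eq_sum_range
        (fun j => ((halfAnglePoly t n).coeff j : ℂ) * halfAngleRoot t n m ^ j),
        Fin.sum_univ_succAbove _ J] at h
      simp only [J, h0, Complex.ofReal_zero, zero_mul, zero_add] at h
      rw [← h]
      refine Finset.sum_congr rfl fun i _ => ?_
      rw [halfAngleRoot_eq t n m]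
      ring
  have hne : Fin.last (2 * t) ≠ J := by
    intro h
    have : 2 * t = j := congrArg Fin.val h
    rw [this, h0] at hlead
    exact zero_ne_one hlead
  obtain ⟨i, hi⟩ := Fin.exists_succAbove_eq hne
  have := congrFun hv i
  simp [hi, hlead, z, halfAngleRoot_ne_zero] at this

lemma coeff_halfAnglePoly_natAbs {t n j : ℕ} (hj : j ≤ 2 * t) :
    (halfAnglePoly t n).coeff (t + ((j : ℤ) - t).natAbs) = (halfAnglePoly t n).coeff j := by
  rcases le_total t j with h | h
  · congr 1; omega
  · conv_rhs => rw [← reverse_halfAnglePoly, Polynomial.coeff_reverse, natDegree_halfAnglePoly,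
      Polynomial.revAt_le hj]
    congr 1; omega

/-- The coefficient of `halfAnglePoly t n` at signed distance `d` from the middle one. -/
def centeredCoeff (t n : ℕ) (d : ℤ) : ℝ := (halfAnglePoly t n).coeff (t + d.natAbs)

lemma centeredCoeff_neg (t n : ℕ) (d : ℤ) : centeredCoeff t n (-d) = centeredCoeff t n d := by
  simp [centeredCoeff]

lemma centeredCoeff_ne_zero_iff {t n : ℕ} (hn : 2 * t + 1 ≤ n) (d : ℤ) :
    centeredCoeff t n d ≠ 0 ↔ d.natAbs ≤ t := by
  constructor
  · intro h
    have := Polynomial.le_natDegree_of_ne_zero h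
    rw [natDegree_halfAnglePoly] at this
    omega
  · intro h
    exact coeff_halfAnglePoly_ne_zero hn (by omega)

lemma centeredCoeff_eq_zero {t n : ℕ} {d : ℤ} (h : t < d.natAbs) : centeredCoeff t n d = 0 :=
  Polynomial.coeff_eq_zero_of_natDegree_lt (by rw [natDegree_halfAnglePoly]; omega)

lemma sum_centeredCoeff {t m : ℕ} (n : ℕ) (hm : m < 2 * t) (a : ℕ) {s : Finset ℤ}
    (hs : ∀ e : ℤ, (e - a).natAbs ≤ t → e ∈ s) :
    ∑ e ∈ s, (centeredCoeff t n (e - a) : ℂ) * halfAngleRoot t n m ^ e = 0 := by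
  set z := halfAngleRoot t n m with hz
  have hz0 : z ≠ 0 := halfAngleRoot_ne_zero _ _ _
  let φ : ℕ ↪ ℤ := ⟨fun j => (j : ℤ) - t + a, fun x y h => by simpa using h⟩
  have hsub : (Finset.range (2 * t + 1)).map φ ⊆ s := by
    intro e he
    obtain ⟨j, hj, rfl⟩ := Finset.mem_map.1 he
    rw [Finset.mem_range] at hj
    refine hs _ ?_
    change ((j : ℤ) - t + a - a).natAbs ≤ t
    omega
  rw [← Finset.sum_subset hsub, Finset.sum_map]
  · have h := congrArg (· * z ^ ((a : ℤ) - t)) (sum_coeff_halfAnglePoly n hm)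
    simp only [Finset.sum_mul, zero_mul] at h
    rw [← h]
    refine Finset.sum_congr rfl fun j hj => ?_
    rw [Finset.mem_range] at hj
    change (centeredCoeff t n ((j : ℤ) - t + a - a) : ℂ) * z ^ ((j : ℤ) - t + a) = _
    rw [add_sub_cancel_right, centeredCoeff, coeff_halfAnglePoly_natAbs (by omega), mul_assoc,
      ← zpow_natCast, ← hz, ← zpow_add₀ hz0]
    congr 2
    ring
  · intro e _ he
    rw [centeredCoeff_eq_zero, Complex.ofReal_zero, zero_mul]
    by_contra hcon
    refine he (Finset.mem_map.2 ⟨(e - a + t).toNat, ?_, ?_⟩)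
    · rw [Finset.mem_range]; omega
    · change (((e - a + t).toNat : ℤ)) - t + a = e
      omega

lemma circG_adj_iff {t n : ℕ} (hn : 2 * t + 1 ≤ n) (i j : ZMod n) :
    (circG n (Set.Icc 1 t)).Adj i j ↔ ∃ e : ℤ, e ≠ 0 ∧ e.natAbs ≤ t ∧ j = i + (e : ZMod n) := by
  simp only [circG, SimpleGraph.fromRel_adj, Set.mem_Icc]
  constructor
  · rintro ⟨-, ⟨s, hs, rfl⟩ | ⟨s, hs, rfl⟩⟩
    · exact ⟨s, by omega, by omega, by simp⟩
    · exact ⟨-s, by omega, by omega, by simp⟩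
  · rintro ⟨e, he0, he, rfl⟩
    refine ⟨fun h => ?_, ?_⟩
    · have h1 : (e : ZMod n) = 0 := by simpa using h.symm
      rw [ZMod.intCast_zmod_eq_zero_iff_dvd] at h1
      exact he0 (Int.eq_zero_of_dvd_of_natAbs_lt_natAbs h1 (by omega))
    · rcases le_total 0 e with h | h
      · refine Or.inl ⟨e.natAbs, by omega, ?_⟩
        rw [← Int.cast_natCast, Int.natAbs_of_nonneg h]
      · refine Or.inr ⟨e.natAbs, by omega, ?_⟩
        rw [← Int.cast_natCast, Int.ofNat_natAbs_of_nonpos h]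
        simp

lemma zmod_eq_add_intCast_iff {n : ℕ} [NeZero n] (i j : ZMod n) (e : ℤ) :
    j = i + (e : ZMod n) ↔ (n : ℤ) ∣ j.val - i.val - e := by
  rw [← ZMod.intCast_zmod_eq_zero_iff_dvd]
  push_cast
  rw [ZMod.natCast_zmod_val, ZMod.natCast_zmod_val, sub_sub, sub_eq_zero]

lemma circG_adj_iff_val {t n : ℕ} [NeZero n] (hn : 2 * t + 1 ≤ n) {i j : ZMod n} (hij : i ≠ j) :
    (circG n (Set.Icc 1 t)).Adj i j ↔ ((j.val : ℤ) - i.val).natAbs ≤ t ∨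
      ((j.val : ℤ) - i.val + n).natAbs ≤ t ∨ ((j.val : ℤ) - i.val - n).natAbs ≤ t := by
  have hi := i.val_lt
  have hj := j.val_lt
  have hv : i.val ≠ j.val := fun h => hij (ZMod.val_injective n h)
  simp only [circG_adj_iff hn, zmod_eq_add_intCast_iff]
  constructor
  · rintro ⟨e, -, he, k, hk⟩
    have h1 : k < 2 := by
      by_contra! h
      nlinarith [(by omega : ((j.val : ℤ) - i.val - e) < 2 * n)]
    have h2 : -2 < k := by
      by_contra! h
      nlinarith [(by omega : -2 * (n : ℤ) < ((j.val : ℤ) - i.val - e))]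
    interval_cases k <;> omega
  · rintro (h | h | h)
    · exact ⟨_, by omega, h, by simp⟩
    · exact ⟨_, by omega, h, by simp⟩
    · exact ⟨_, by omega, h, by simp⟩

/-- The skew-circulant matrix whose bands carry the coefficients of `halfAnglePoly t n`. -/
def skewCirculant (t n : ℕ) : Matrix (ZMod n) (ZMod n) ℝ :=
  Matrix.of fun i j => centeredCoeff t n ((j.val : ℤ) - i.val)
    - centeredCoeff t n ((j.val : ℤ) - i.val + n) - centeredCoeff t n ((j.val : ℤ) - i.val - n)

lemma sMat_skewCirculant {t n : ℕ} [NeZero n] (hn : 2 * t + 1 ≤ n) :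
    SMat ℝ (circG n (Set.Icc 1 t)) (skewCirculant t n) := by
  refine ⟨?_, fun i j hij => ?_⟩
  · ext i j
    simp only [skewCirculant, Matrix.transpose_apply, Matrix.of_apply]
    rw [← centeredCoeff_neg t n (i.val - j.val), ← centeredCoeff_neg t n (i.val - j.val + n),
      ← centeredCoeff_neg t n (i.val - j.val - n), sub_right_comm]
    congr 3 <;> ring
  · rw [circG_adj_iff_val hn hij]
    simp only [← centeredCoeff_ne_zero_iff hn, skewCirculant, Matrix.of_apply]
    set d : ℤ := (j.val : ℤ) - i.val
    by_cases h1 : d.natAbs ≤ t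
    · rw [centeredCoeff_eq_zero (d := d + n) (by omega),
        centeredCoeff_eq_zero (d := d - n) (by omega)]
      simp
    · rw [centeredCoeff_eq_zero (d := d) (by omega)]
      by_cases h2 : (d + n).natAbs ≤ t
      · rw [centeredCoeff_eq_zero (d := d - n) (by omega)]
        simp
      · rw [centeredCoeff_eq_zero (d := d + n) (by omega)]
        simp

lemma skewCirculant_mul_root {t m : ℕ} (n : ℕ) [NeZero n] (hn : 2 * t + 1 ≤ n) (hm : m < 2 * t)
    (i : ZMod n) :
    ∑ j : ZMod n, (skewCirculant t n i j : ℂ) * halfAngleRoot t n m ^ j.val = 0 := by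
  set z := halfAngleRoot t n m with hz
  have hz0 : z ≠ 0 := halfAngleRoot_ne_zero _ _ _
  have hzn : z ^ (n : ℤ) = -1 := by rw [zpow_natCast]; exact halfAngleRoot_pow (NeZero.ne n) _ _
  let c : ℤ → ℂ := fun e => (centeredCoeff t n (e - i.val) : ℂ) * z ^ e
  have hi := i.val_lt
  have h1 : ∑ j : ZMod n, (skewCirculant t n i j : ℂ) * z ^ j.val =
      ∑ k ∈ Finset.range n, (c k + c (k + n) + c (k - n)) := by
    refine Finset.sum_nbij' ZMod.val (fun k => (k : ZMod n)) ?_ ?_ ?_ ?_ ?_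
    · intro j _
      simpa using j.val_lt
    · simp
    · simp
    · intro k hk
      exact ZMod.val_cast_of_lt (Finset.mem_range.1 hk)
    · intro j _
      simp only [c, skewCirculant, Matrix.of_apply]
      rw [zpow_add₀ hz0, zpow_sub₀ hz0, hzn, zpow_natCast]
      push_cast
      rw [show (j.val : ℤ) + n - i.val = j.val - i.val + n by ring,
        show (j.val : ℤ) - n - i.val = j.val - i.val - n by ring]
      ring
  let φ : ℕ ↪ ℤ := ⟨fun k => (k : ℤ) - n, fun x y h => by simpa using h⟩
  have h2 : ∑ e ∈ (Finset.range (n + n + n)).map φ, c e = 0 := by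
    refine sum_centeredCoeff n hm i.val fun e he => Finset.mem_map.2 ⟨(e + n).toNat, ?_, ?_⟩
    · rw [Finset.mem_range]; omega
    · change (((e + n).toNat : ℤ)) - n = e
      omega
  rw [h1, ← h2, Finset.sum_map, Finset.sum_range_add, Finset.sum_range_add,
    ← Finset.sum_add_distrib, ← Finset.sum_add_distrib]
  refine Finset.sum_congr rfl fun k _ => ?_
  change _ = c ((k : ℤ) - n) + c (((n + k : ℕ) : ℤ) - n) + c (((n + n + k : ℕ) : ℤ) - n)
  push_cast
  rw [show (n : ℤ) + k - n = k by ring, show (n : ℤ) + n + k - n = k + n by ring]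
  ring

lemma rank_le_rank_map_ofReal {m n : Type*} [Fintype m] [Fintype n] (A : Matrix m n ℝ) :
    A.rank ≤ (A.map Complex.ofReal).rank := by
  obtain ⟨κ, a, ha, hspan, hli⟩ := exists_linearIndependent' ℝ A.col
  have : Fintype κ := Fintype.ofInjective a ha
  have hC : LinearIndependent ℂ ((A.map Complex.ofReal).col ∘ a) := by
    rw [← linearIndependent_algebraMap_comp_iff (S := ℂ)] at hli
    exact hli
  calc A.rank = Fintype.card κ := by
        rw [Matrix.rank_eq_finrank_span_cols, ← hspan, finrank_span_eq_card hli]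
    _ = Module.finrank ℂ (Submodule.span ℂ (Set.range ((A.map Complex.ofReal).col ∘ a))) :=
        (finrank_span_eq_card hC).symm
    _ ≤ _ := by
        rw [Matrix.rank_eq_finrank_span_cols]
        exact Submodule.finrank_mono (Submodule.span_mono (Set.range_comp_subset_range _ _))

lemma rank_skewCirculant_add_le {t n : ℕ} [NeZero n] (hn : 2 * t + 1 ≤ n) :
    (skewCirculant t n).rank + 2 * t ≤ n := by
  let W : Matrix (Fin (2 * t)) (ZMod n) ℂ := Matrix.of fun m j => halfAngleRoot t n m ^ j.val
  have hinj : Function.Injective fun m : Fin (2 * t) => halfAngleRoot t n m := by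
    intro a b h
    simp only [halfAngleRoot_eq t n a, halfAngleRoot_eq t n b] at h
    exact Fin.ext (rootOfUnity_pow_injOn (by omega) (by omega)
      (mul_left_cancel₀ (halfAngleRoot_ne_zero _ _ _) h))
  have hW : W.rank = 2 * t := by
    rw [LinearIndependent.rank_matrix, Fintype.card_fin]
    rw [Fintype.linearIndependent_iff]
    intro c hc
    refine congrFun (Matrix.eq_zero_of_forall_pow_sum_mul_pow_eq_zero hinj fun k => ?_)
    have := congrFun hc ((k : ℕ) : ZMod n)
    simpa [W, Matrix.row, ZMod.val_cast_of_lt (show (k : ℕ) < n by omega)] using this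
  have hmul : (skewCirculant t n).map Complex.ofReal * W.transpose = 0 := by
    ext i m
    rw [Matrix.mul_apply]
    exact skewCirculant_mul_root n hn m.2 i
  have h1 := Matrix.rank_add_rank_le_card_of_mul_eq_zero hmul
  rw [Matrix.rank_transpose, hW, ZMod.card] at h1
  have h2 := rank_le_rank_map_ofReal (skewCirculant t n)
  omega

lemma eq_zero_of_forced [Fintype V] {F : Type*} [Field F] {G : SimpleGraph V} {A : Matrix V V F}
    (hA : SMat F G A) {Z : Set V} {x : V → F} (hx : A.mulVec x = 0) (hZ : ∀ v ∈ Z, x v = 0)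
    {v : V} (hv : Forced G Z v) : x v = 0 := by
  induction hv with
  | init v h => exact hZ v h
  | force u w _ huw _ ihu ih =>
    have h := congrFun hx u
    rw [Matrix.mulVec, dotProduct, Finset.sum_eq_single w] at h
    · exact (mul_eq_zero.1 h).resolve_left ((hA.2 u w huw.ne).2 huw)
    · intro b _ hb
      rcases eq_or_ne u b with rfl | hub
      · rw [ihu, mul_zero]
      · by_cases hadj : G.Adj u b
        · rw [ih b hadj hb, mul_zero]
        · rw [not_not.1 (mt (hA.2 u b hub).1 hadj), zero_mul]
    · simp

lemma card_sub_rank_le_ncard [Fintype V] {F : Type*} [Field F] {G : SimpleGraph V}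
    {A : Matrix V V F} (hA : SMat F G A) {Z : Set V} (hZ : IsZeroForcingSet G Z) :
    Fintype.card V - A.rank ≤ Z.ncard := by
  let f : LinearMap.ker A.mulVecLin →ₗ[F] (Z → F) :=
    (LinearMap.funLeft F F ((↑) : Z → V)).comp (Submodule.subtype _)
  have hf : Function.Injective f := by
    rw [injective_iff_map_eq_zero]
    rintro ⟨x, hx⟩ h
    ext v
    exact eq_zero_of_forced hA hx (fun w hw => congrFun h ⟨w, hw⟩) (hZ v)
  have h1 := LinearMap.finrank_le_finrank_of_injective hf
  rw [Module.finrank_fintype_fun_eq_card, ← Nat.card_eq_fintype_card, Nat.card_coe_set_eq] at h1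
  have h2 := LinearMap.finrank_range_add_finrank_ker A.mulVecLin
  rw [Module.finrank_fintype_fun_eq_card] at h2
  change A.rank + _ = _ at h2
  omega

lemma hasSAP_of_isZeroForcingSet_closedNeighborSet [Fintype V] [DecidableEq V]
    {G : SimpleGraph V} {A : Matrix V V ℝ} (hA : SMat ℝ G A)
    (hG : ∀ v, IsZeroForcingSet G (insert v (G.neighborSet v))) : HasSAP A := by
  intro X hX hAX hAdj hdiag
  ext i j
  refine eq_zero_of_forced hA (x := X.col j) ?_ ?_ (hG j i)
  · ext k
    exact congrFun (congrFun hAX k) j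
  · rintro v (rfl | hv)
    · simpa using congrFun (congrFun hdiag v) v
    · have h := congrFun (congrFun hAdj v) j
      exact (mul_eq_zero.1 h).resolve_left ((hA.2 v j hv.ne').2 hv.symm)

lemma isZeroForcingSet_circG_of_window {t n : ℕ} [NeZero n] (ht : 1 ≤ t) (hn : 2 * t + 1 ≤ n)
    {Z : Set (ZMod n)} (v : ZMod n) (hZ : ∀ k : ℕ, k < 2 * t → v + k ∈ Z) :
    IsZeroForcingSet (circG n (Set.Icc 1 t)) Z := by
  have key : ∀ k : ℕ, Forced (circG n (Set.Icc 1 t)) Z (v + k) := by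
    intro k
    induction k using Nat.strong_induction_on with
    | _ k ih =>
      rcases lt_or_ge k (2 * t) with h | h
      · exact .init _ (hZ k h)
      · refine .force (v + (k - t : ℕ)) _ (ih _ (by omega)) ?_ ?_
        · rw [circG_adj_iff hn]
          refine ⟨t, by omega, by omega, ?_⟩
          rw [Int.cast_natCast, add_assoc, ← Nat.cast_add, Nat.sub_add_cancel (by omega)]
        · intro x hx hne
          obtain ⟨e, he0, he, rfl⟩ := (circG_adj_iff hn _ _).1 hx
          have hcast : v + ((k - t : ℕ) : ZMod n) + (e : ZMod n) =
              v + ((((k - t : ℕ) : ℤ) + e).toNat : ZMod n) := by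
            rw [← Int.cast_natCast (R := ZMod n) (Int.toNat _), Int.toNat_of_nonneg (by omega)]
            push_cast
            ring
          rw [hcast] at hne ⊢
          refine ih _ ?_
          have : (((k - t : ℕ) : ℤ) + e).toNat ≠ k := fun h => hne (by rw [h])
          omega
  intro w
  have := key (w - v).val
  rwa [ZMod.natCast_zmod_val, add_sub_cancel] at this

lemma ncard_neighborSet_circG {t n : ℕ} (hn : 2 * t + 1 ≤ n) (v : ZMod n) :
    ((circG n (Set.Icc 1 t)).neighborSet v).ncard = 2 * t := by
  have h : (circG n (Set.Icc 1 t)).neighborSet v =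
      (fun e : ℤ => v + (e : ZMod n)) '' ((Finset.Icc (-t : ℤ) t).erase 0 : Finset ℤ) := by
    ext w
    rw [SimpleGraph.mem_neighborSet, circG_adj_iff hn]
    simp only [Set.mem_image, Finset.mem_coe, Finset.mem_erase, Finset.mem_Icc]
    constructor
    · rintro ⟨e, h0, h1, rfl⟩
      exact ⟨e, ⟨h0, by omega⟩, rfl⟩
    · rintro ⟨e, ⟨h0, h1⟩, rfl⟩
      exact ⟨e, h0, by omega, rfl⟩
  rw [h, Set.InjOn.ncard_image, Set.ncard_coe_finset, Finset.card_erase_of_mem (by simp),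
    Int.card_Icc]
  · omega
  · intro a ha b hb hab
    simp only [Finset.mem_coe, Finset.mem_erase, Finset.mem_Icc] at ha hb
    have h1 : (a : ZMod n) = b := add_left_cancel hab
    rw [ZMod.intCast_eq_intCast_iff_dvd_sub] at h1
    have := Int.eq_zero_of_dvd_of_natAbs_lt_natAbs h1 (by omega)
    omega

lemma minDeg_circG {t n : ℕ} (hn : 2 * t + 1 ≤ n) : minDeg (circG n (Set.Icc 1 t)) = 2 * t := by
  have : {d | ∃ v : ZMod n, ((circG n (Set.Icc 1 t)).neighborSet v).ncard = d} = {2 * t} := by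
    ext d
    simp [ncard_neighborSet_circG hn, eq_comm]
  rw [minDeg, this, csInf_singleton]

lemma reachable_induce_compl_circG {t n : ℕ} (hn : 2 * t + 1 ≤ n) (S : Set (ZMod n)) (d : ℕ) :
    ∀ (x : ZMod n) (hx : x ∈ Sᶜ) (hy : x + d ∈ Sᶜ),
      ((Finset.Ioo 0 d).filter fun e : ℕ => x + (e : ZMod n) ∈ S).card < t →
      ((circG n (Set.Icc 1 t)).induce Sᶜ).Reachable ⟨x, hx⟩ ⟨x + d, hy⟩ := by
  induction d using Nat.strong_induction_on with
  | _ d ih =>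
    intro x hx hy hcard
    rcases Nat.eq_zero_or_pos d with rfl | hd
    · simp
    rcases le_or_gt d t with hdt | hdt
    · refine SimpleGraph.Adj.reachable ?_
      rw [SimpleGraph.induce_adj, circG_adj_iff hn]
      exact ⟨d, by omega, by omega, by simp⟩
    · have : ∃ e ∈ Finset.Icc 1 t, x + (e : ZMod n) ∉ S := by
        by_contra! hall
        have hsub : Finset.Icc 1 t ⊆
            (Finset.Ioo 0 d).filter fun e : ℕ => x + (e : ZMod n) ∈ S := by
          intro e he
          rw [Finset.mem_filter, Finset.mem_Ioo]
          refine ⟨?_, hall e he⟩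
          rw [Finset.mem_Icc] at he
          omega
        have := Finset.card_le_card hsub
        rw [Nat.card_Icc] at this
        omega
      obtain ⟨e, he, heS⟩ := this
      rw [Finset.mem_Icc] at he
      have hsum : x + (e : ZMod n) + ((d - e : ℕ) : ZMod n) = x + d := by
        rw [add_assoc, ← Nat.cast_add, Nat.add_sub_cancel' (by omega)]
      have h1 : ((circG n (Set.Icc 1 t)).induce Sᶜ).Reachable ⟨x, hx⟩ ⟨x + e, heS⟩ := by
        refine SimpleGraph.Adj.reachable ?_
        rw [SimpleGraph.induce_adj, circG_adj_iff hn]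
        exact ⟨e, by omega, by omega, by simp⟩
      have h2 := ih (d - e) (by omega) (x + e) heS (by rw [hsum]; exact hy) (by
        refine lt_of_le_of_lt (Finset.card_le_card_of_injOn (fun a => e + a) ?_ ?_) hcard
        · intro a ha
          simp only [Finset.coe_filter, Finset.mem_Ioo, Set.mem_ofPred_eq] at ha ⊢
          refine ⟨by omega, ?_⟩
          rw [Nat.cast_add, ← add_assoc]
          exact ha.2
        · intro a _ b _ h
          simpa using h)
      simp only [hsum] at h2
      exact h1.trans h2

lemma card_filter_Ioo_add_card_filter_Ioo_le {n : ℕ} [NeZero n] (S : Set (ZMod n)) (x : ZMod n)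
    {d : ℕ} (hd : d < n) :
    ((Finset.Ioo 0 d).filter fun e : ℕ => x + (e : ZMod n) ∈ S).card +
      ((Finset.Ioo 0 (n - d)).filter fun e : ℕ => x + d + (e : ZMod n) ∈ S).card ≤ S.ncard := by
  have h1 : ((Finset.Ioo 0 (n - d)).filter fun e : ℕ => x + d + (e : ZMod n) ∈ S).card =
      ((Finset.Ioo d n).filter fun e : ℕ => x + (e : ZMod n) ∈ S).card := by
    refine Finset.card_nbij' (fun e => d + e) (fun e => e - d) ?_ ?_ ?_ ?_
    · intro a ha
      simp only [Finset.coe_filter, Finset.mem_Ioo, Set.mem_ofPred_eq] at ha ⊢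
      refine ⟨by omega, ?_⟩
      rw [Nat.cast_add, ← add_assoc]
      exact ha.2
    · intro a ha
      simp only [Finset.coe_filter, Finset.mem_Ioo, Set.mem_ofPred_eq] at ha ⊢
      refine ⟨by omega, ?_⟩
      rw [add_assoc, ← Nat.cast_add, Nat.add_sub_cancel' (by omega)]
      exact ha.2
    · intro a _
      simp
    · intro a ha
      simp only [Finset.coe_filter, Finset.mem_Ioo, Set.mem_ofPred_eq] at ha
      change d + (a - d) = a
      omega
  rw [h1, ← Finset.card_union_of_disjoint, ← Set.ncard_coe_finset]
  · refine Set.ncard_le_ncard_of_injOn (fun e : ℕ => x + (e : ZMod n)) ?_ ?_ (Set.toFinite S)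
    · intro a ha
      simp only [Finset.coe_union, Finset.coe_filter, Set.mem_union, Set.mem_ofPred_eq] at ha
      rcases ha with h | h <;> exact h.2
    · intro a ha b hb h
      simp only [Finset.coe_union, Finset.coe_filter, Set.mem_union, Set.mem_ofPred_eq,
        Finset.mem_Ioo] at ha hb
      have h' := congrArg ZMod.val (add_left_cancel h)
      rwa [ZMod.val_cast_of_lt (by omega), ZMod.val_cast_of_lt (by omega)] at h'
  · rw [Finset.disjoint_left]
    intro a ha hb
    simp only [Finset.mem_filter, Finset.mem_Ioo] at ha hb
    omega

lemma connected_induce_compl_circG {t n : ℕ} [NeZero n] (hn : 2 * t + 1 ≤ n) {S : Set (ZMod n)}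
    (hS : S.ncard < 2 * t) : ((circG n (Set.Icc 1 t)).induce Sᶜ).Connected := by
  have hne : Sᶜ.Nonempty := by
    rw [Set.nonempty_compl]
    rintro rfl
    rw [Set.ncard_univ, Nat.card_zmod] at hS
    omega
  have : Nonempty ↥Sᶜ := hne.to_subtype
  refine ⟨?_⟩
  rintro ⟨x, hx⟩ ⟨y, hy⟩
  obtain ⟨d, hd, rfl⟩ : ∃ d : ℕ, d < n ∧ y = x + d :=
    ⟨(y - x).val, ZMod.val_lt _, by rw [ZMod.natCast_zmod_val, add_sub_cancel]⟩
  have hcard := card_filter_Ioo_add_card_filter_Ioo_le S x hd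
  by_cases h : ((Finset.Ioo 0 d).filter fun e : ℕ => x + (e : ZMod n) ∈ S).card < t
  · exact reachable_induce_compl_circG hn S d x hx hy h
  · have hback : x + (d : ZMod n) + ((n - d : ℕ) : ZMod n) = x := by
      rw [add_assoc, ← Nat.cast_add, Nat.add_sub_cancel' hd.le, ZMod.natCast_self, add_zero]
    have := reachable_induce_compl_circG hn S (n - d) (x + d) hy (by rwa [hback]) (by omega)
    simp only [hback] at this
    exact this.symm

lemma not_connected_induce_compl_neighborSet {G : SimpleGraph V} {u v : V} (huv : u ≠ v)
    (hadj : ¬ G.Adj u v) : ¬ (G.induce (G.neighborSet u)ᶜ).Connected := by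
  intro h
  have hu : u ∈ (G.neighborSet u)ᶜ := by simp
  have : Nontrivial ↥(G.neighborSet u)ᶜ :=
    ⟨⟨u, hu⟩, ⟨v, hadj⟩, fun h => huv (congrArg Subtype.val h)⟩
  obtain ⟨⟨w, hw⟩, hw'⟩ := h.preconnected.exists_adj_of_nontrivial ⟨u, hu⟩
  exact hw hw'

lemma vertexConnectivity_circG {t n : ℕ} [NeZero n] (hn : 2 * t + 1 ≤ n) :
    vertexConnectivity (circG n (Set.Icc 1 t)) = 2 * t := by
  rw [vertexConnectivity]
  split_ifs with htop
  · have h := ncard_neighborSet_circG hn (0 : ZMod n)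
    rw [htop, SimpleGraph.neighborSet_top, Set.ncard_compl, Nat.card_zmod,
      Set.ncard_singleton] at h
    rw [ZMod.card, h]
  · obtain ⟨u, v, huv, hadj⟩ := SimpleGraph.ne_top_iff_exists_not_adj.1 htop
    have hmem : 2 * t ∈ {m | ∃ S : Set (ZMod n), S.ncard = m ∧
        ¬ ((circG n (Set.Icc 1 t)).induce Sᶜ).Connected} :=
      ⟨_, ncard_neighborSet_circG hn u, not_connected_induce_compl_neighborSet huv hadj⟩
    refine le_antisymm (Nat.sInf_le hmem) (le_csInf ⟨_, hmem⟩ ?_)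
    rintro m ⟨S, rfl, hS⟩
    by_contra! hlt
    exact hS (connected_induce_compl_circG hn hlt)

theorem stmt13 (t n : ℕ) (ht : 1 ≤ t) (hn : 2 * t + 1 ≤ n) :
    haveI : NeZero n := ⟨by omega⟩
    vertexConnectivity (circG n (Set.Icc 1 t)) = 2 * t ∧
    minDeg (circG n (Set.Icc 1 t)) = 2 * t ∧
    xi (circG n (Set.Icc 1 t)) = 2 * t ∧
    maxNullity ℝ (circG n (Set.Icc 1 t)) = 2 * t ∧
    zfn (circG n (Set.Icc 1 t)) = 2 * t := by
  have : NeZero n := ⟨by omega⟩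
  let Z : Set (ZMod n) := (fun k : ℕ => (0 : ZMod n) + k) '' (Finset.range (2 * t) : Finset ℕ)
  have hZ : IsZeroForcingSet (circG n (Set.Icc 1 t)) Z :=
    isZeroForcingSet_circG_of_window ht hn 0 fun k hk => ⟨k, by simpa using hk, rfl⟩
  have hZcard : Z.ncard ≤ 2 * t := by
    refine (Set.ncard_image_le (Finset.finite_toSet _)).trans ?_
    rw [Set.ncard_coe_finset, Finset.card_range]
  have hA := sMat_skewCirculant (t := t) hn
  have hle : ∀ {A : Matrix (ZMod n) (ZMod n) ℝ}, SMat ℝ (circG n (Set.Icc 1 t)) A →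
      Fintype.card (ZMod n) - A.rank ≤ 2 * t :=
    fun hA => (card_sub_rank_le_ncard hA hZ).trans hZcard
  have hnull : 2 * t ≤ Fintype.card (ZMod n) - (skewCirculant t n).rank := by
    have := rank_skewCirculant_add_le hn
    rw [ZMod.card]
    omega
  have hSAP : HasSAP (skewCirculant t n) := by
    refine hasSAP_of_isZeroForcingSet_closedNeighborSet hA fun v =>
      isZeroForcingSet_circG_of_window ht hn (v - t) fun k hk => ?_
    rcases eq_or_ne k t with rfl | hkt
    · simp
    · refine Or.inr ((circG_adj_iff hn _ _).2 ⟨(k : ℤ) - t, by omega, by omega, ?_⟩)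
      push_cast
      ring
  refine ⟨vertexConnectivity_circG hn, minDeg_circG hn, ?_, ?_, ?_⟩
  · refine IsGreatest.csSup_eq ⟨⟨_, hA, hSAP, (hle hA).antisymm hnull⟩, ?_⟩
    rintro m ⟨A, hA, -, rfl⟩
    exact hle hA
  · refine IsGreatest.csSup_eq ⟨⟨_, hA, (hle hA).antisymm hnull⟩, ?_⟩
    rintro m ⟨A, hA, rfl⟩
    exact hle hA
  · have hmem : Z.ncard ∈ {m | ∃ Y : Set (ZMod n), Y.ncard = m ∧
        IsZeroForcingSet (circG n (Set.Icc 1 t)) Y} := ⟨Z, rfl, hZ⟩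
    refine le_antisymm ((Nat.sInf_le hmem).trans hZcard) (le_csInf ⟨_, hmem⟩ ?_)
    rintro m ⟨Y, rfl, hY⟩
    exact hnull.trans (card_sub_rank_le_ncard hA hY)

end Paper
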